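/- Error bound for point-based value iteration: under the stated hypotheses (nonexpansive transitions, c-Lipschitz rewards, γ ∈ [0,1), sampled sets S̃_τ of density δ among reachable points, backup domination at sampled points, and Lipschitz value estimates with constants c(1−γ^{ℓ−τ})/(1−γ)), the value v_0 produced by the point-based algorithm satisfies V*_0(s_0) − v_0(s_0) ≤ 2·c·δ·(1 + ℓ·γ^{ℓ+1} − (ℓ+1)·γ^ℓ)/(1−γ)². -/

import Mathlib

/-- Probability vectors on a finite set `Y`. -/
def ProbVec (Y : Type) [Fintype Y] : Type :=
  {s : Y → ℝ // (∀ y, 0 ≤ s y) ∧ ∑ y, s y = 1}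

/-- ℓ¹ distance between probability vectors. -/
noncomputable def dist1 {Y : Type} [Fintype Y] (s s' : ProbVec Y) : ℝ :=
  ∑ y, |s.1 y - s'.1 y|

/-- Optimal value with `k` stages to go: `Vopt T R γ k` is `V*_{ℓ-k}` for horizon `ℓ`. -/
noncomputable def Vopt {S A : Type} [Fintype A] [Nonempty A]
    (T : S → A → S) (R : S → A → ℝ) (γ : ℝ) : ℕ → S → ℝ
  | 0, _ => 0
  | k + 1, s =>
    Finset.univ.sup' Finset.univ_nonempty fun a : A =>
      R s a + γ * Vopt T R γ k (T s a)

/-- `reach T s0 τ s` : `s` is obtained from `s0` by applying `τ` transitions. -/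
def reach {S A : Type} (T : S → A → S) (s0 : S) : ℕ → S → Prop
  | 0, s => s = s0
  | τ + 1, s => ∃ s' a, reach T s0 τ s' ∧ s = T s' a

/-- One-step Bellman comparison: a value estimate that dominates its backup at a sample `t` close
to `s` dominates the backup at `s` up to `δ` times the Lipschitz constants involved. -/
theorem backup_le_add_of_near_sample {S A : Type} {d : S → S → ℝ} {T : S → A → S}
    {R : S → A → ℝ} {v w : S → ℝ} {γ c δ K L : ℝ} (hγ : 0 ≤ γ) (hc : 0 ≤ c) (hK : 0 ≤ K)
    (hL : 0 ≤ L) (hT : ∀ s s' a, d (T s a) (T s' a) ≤ d s s')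
    (hR : ∀ s s' a, |R s a - R s' a| ≤ c * d s s')
    (hv : ∀ s s', |v s - v s'| ≤ L * d s s') (hw : ∀ s s', |w s - w s'| ≤ K * d s s')
    {s t : S} {a : A} (hst : d s t ≤ δ) (ht : R t a + γ * w (T t a) ≤ v t) :
    R s a + γ * w (T s a) ≤ v s + (c + γ * K + L) * δ := by
  have h1 := (abs_le.1 ((hR s t a).trans (mul_le_mul_of_nonneg_left hst hc))).2
  have h2 := (abs_le.1 ((hv s t).trans (mul_le_mul_of_nonneg_left hst hL))).1
  have h3 := (abs_le.1 ((hw (T s a) (T t a)).trans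
    (mul_le_mul_of_nonneg_left ((hT s t a).trans hst) hK))).2
  have h4 := mul_le_mul_of_nonneg_left h3 hγ
  linarith

theorem stmt6 (Y : Type) [Fintype Y] [Nonempty Y] (A : Type) [Fintype A] [Nonempty A]
    (T : ProbVec Y → A → ProbVec Y) (R : ProbVec Y → A → ℝ)
    (γ c δ : ℝ) (hγ0 : 0 ≤ γ) (hγ1 : γ < 1) (hc : 0 ≤ c) (hδ : 0 ≤ δ)
    (ℓ : ℕ) (s0 : ProbVec Y)
    (hT : ∀ s s' a, dist1 (T s a) (T s' a) ≤ dist1 s s')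
    (hR : ∀ s s' a, |R s a - R s' a| ≤ c * dist1 s s')
    (St : ℕ → Set (ProbVec Y)) (v : ℕ → ProbVec Y → ℝ)
    (hvℓ : ∀ s, v ℓ s = 0)
    (hdens : ∀ τ, τ < ℓ → ∀ s, reach T s0 τ s → ∃ st ∈ St τ, dist1 s st ≤ δ)
    (hbackup : ∀ τ, τ < ℓ → ∀ st ∈ St τ, ∀ a, R st a + γ * v (τ + 1) (T st a) ≤ v τ st)
    (hlip : ∀ τ, τ < ℓ → ∀ s s',
      |v τ s - v τ s'| ≤ c * (1 - γ ^ (ℓ - τ)) / (1 - γ) * dist1 s s') :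
    Vopt T R γ ℓ s0 - v 0 s0 ≤
      2 * c * δ * (1 + (ℓ : ℝ) * γ ^ (ℓ + 1) - ((ℓ : ℝ) + 1) * γ ^ ℓ) / (1 - γ) ^ 2 := by
  have hγ : 1 - γ ≠ 0 := (sub_pos.2 hγ1).ne'
  have hL : ∀ k : ℕ, 0 ≤ c * (1 - γ ^ k) / (1 - γ) := fun k =>
    div_nonneg (mul_nonneg hc (sub_nonneg.2 (pow_le_one₀ hγ0 hγ1.le))) (sub_pos.2 hγ1).le
  have hlip' : ∀ τ k, τ + k = ℓ → ∀ s s',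
      |v τ s - v τ s'| ≤ c * (1 - γ ^ k) / (1 - γ) * dist1 s s' := by
    intro τ k hk s s'
    rcases Nat.eq_zero_or_pos k with rfl | hpos
    · obtain rfl : τ = ℓ := hk
      simp [hvℓ]
    · have h := hlip τ (by omega) s s'
      rwa [show ℓ - τ = k by omega] at h
  have key : ∀ k τ, τ + k = ℓ → ∀ s, reach T s0 τ s → Vopt T R γ k s ≤ v τ s +
      2 * c * δ * (1 + (k : ℝ) * γ ^ (k + 1) - ((k : ℝ) + 1) * γ ^ k) / (1 - γ) ^ 2 := by
    intro k
    induction k with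
    | zero =>
      intro τ hk s _
      obtain rfl : τ = ℓ := hk
      simp [Vopt, hvℓ]
    | succ k ih =>
      intro τ hk s hs
      have hτ : τ < ℓ := by omega
      obtain ⟨t, ht, hst⟩ := hdens τ hτ s hs
      refine Finset.sup'_le _ _ fun a _ => ?_
      have hnext := mul_le_mul_of_nonneg_left
        (ih (τ + 1) (by omega) (T s a) ⟨s, a, hs, rfl⟩) hγ0
      have hstep := backup_le_add_of_near_sample hγ0 hc (hL k) (hL (k + 1)) hT hR
        (hlip' τ (k + 1) hk) (hlip' (τ + 1) k (by omega)) hst (hbackup τ hτ t ht a)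
      have hsum : (c + γ * (c * (1 - γ ^ k) / (1 - γ)) + c * (1 - γ ^ (k + 1)) / (1 - γ)) * δ +
          γ * (2 * c * δ * (1 + (k : ℝ) * γ ^ (k + 1) - ((k : ℝ) + 1) * γ ^ k) / (1 - γ) ^ 2) =
          2 * c * δ * (1 + ((k + 1 : ℕ) : ℝ) * γ ^ (k + 1 + 1) -
            (((k + 1 : ℕ) : ℝ) + 1) * γ ^ (k + 1)) / (1 - γ) ^ 2 := by
        push_cast
        field_simp
        ring
      linarith
  linarith [key ℓ 0 (Nat.zero_add ℓ) s0 rfl]
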